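/- Fix N ≥ 2 and let an N-branch star-local model be given. Setting I = ⟨(a¹_0+a¹_1)/2 ⋯ (a^N_0+a^N_1)/2 · b_0⟩ and J = ⟨(a¹_0−a¹_1)/2 ⋯ (a^N_0−a^N_1)/2 · b_1⟩, one has |I|^{1/N} + |J|^{1/N} ≤ 1 (the star-network Bell inequality). -/

import Mathlib

open MeasureTheory

/-- The correlator of a product of bounded one-site functions with a function bounded by one is
at most the product of the one-site absolute moments. -/
theorem abs_integral_prod_mul_le {ι : Type*} [Fintype ι] {Λ : ι → Type*}
    [∀ i, MeasurableSpace (Λ i)] (ρ : ∀ i, Measure (Λ i)) [∀ i, IsProbabilityMeasure (ρ i)]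
    {f : ∀ i, Λ i → ℝ} (hf : ∀ i, Integrable (f i) (ρ i))
    {g : (∀ i, Λ i) → ℝ} (hg : ∀ l, |g l| ≤ 1) :
    |∫ l, (∏ i, f i (l i)) * g l ∂(Measure.pi ρ)| ≤ ∏ i, ∫ l, |f i l| ∂(ρ i) := by
  rw [← integral_fintype_prod_eq_prod (fun i l => |f i l|), ← Real.norm_eq_abs]
  refine norm_integral_le_of_norm_le (Integrable.fintype_prod_dep fun i => (hf i).abs)
    (.of_forall fun l => ?_)
  rw [Real.norm_eq_abs, abs_mul, Finset.abs_prod]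
  exact mul_le_of_le_one_right (Finset.prod_nonneg fun i _ => abs_nonneg _) (hg l)

/-- The unweighted AM-GM inequality over `Fin N`. -/
theorem prod_rpow_one_div_le_sum_div {N : ℕ} (hN : N ≠ 0) {p : Fin N → ℝ} (hp : ∀ i, 0 ≤ p i) :
    (∏ i, p i) ^ ((1 : ℝ) / N) ≤ (∑ i, p i) / N := by
  have h := Real.geom_mean_le_arith_mean Finset.univ (fun _ => 1) p (by simp)
    (by simpa using Nat.pos_of_ne_zero hN) (fun i _ => hp i)
  simpa using h

/-- **Star-network Bell inequality.** Fix `N ≥ 2` and let an `N`-branch star-local model be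
given: independent sources `(Λ_i, ρ_i)`, measurable ±1-valued responses
`a^i : {0,1}×Λ_i → {−1,1}` for the branch parties and `b : {0,1}×Λ₁×⋯×Λ_N → {−1,1}` for the
central party. Setting `I = ⟨(a¹_0+a¹_1)/2 ⋯ (a^N_0+a^N_1)/2 · b_0⟩` and
`J = ⟨(a¹_0−a¹_1)/2 ⋯ (a^N_0−a^N_1)/2 · b_1⟩`, one has `|I|^{1/N} + |J|^{1/N} ≤ 1`. -/
theorem star_network_inequality
    (N : ℕ) (hN : 2 ≤ N)
    (Λ : Fin N → Type) [∀ i, MeasurableSpace (Λ i)]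
    (ρ : ∀ i, Measure (Λ i)) [∀ i, IsProbabilityMeasure (ρ i)]
    (a : ∀ i : Fin N, Fin 2 → Λ i → ℝ)
    (b : Fin 2 → (∀ i, Λ i) → ℝ)
    (ha_meas : ∀ i x, Measurable (a i x))
    (hb_meas : ∀ y, Measurable (b y))
    (ha_val : ∀ i x l, a i x l = 1 ∨ a i x l = -1)
    (hb_val : ∀ y lam, b y lam = 1 ∨ b y lam = -1)
    (I J : ℝ)
    (hI : I = ∫ lam, (∏ i, (a i 0 (lam i) + a i 1 (lam i)) / 2) * b 0 lam ∂(Measure.pi ρ))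
    (hJ : J = ∫ lam, (∏ i, (a i 0 (lam i) - a i 1 (lam i)) / 2) * b 1 lam ∂(Measure.pi ρ)) :
    |I| ^ ((1:ℝ)/N) + |J| ^ ((1:ℝ)/N) ≤ 1 := by
  have hN0 : N ≠ 0 := by lia
  have hint : ∀ i x, Integrable (a i x) (ρ i) := fun i x =>
    Integrable.of_bound (ha_meas i x).aestronglyMeasurable 1
      (.of_forall fun l => by rcases ha_val i x l with h | h <;> simp [h])
  have hb : ∀ y l, |b y l| ≤ 1 := fun y l => by rcases hb_val y l with h | h <;> simp [h]
  have hadd : ∀ i, Integrable (fun l => (a i 0 l + a i 1 l) / 2) (ρ i) := fun i =>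
    ((hint i 0).add (hint i 1)).div_const 2
  have hsub : ∀ i, Integrable (fun l => (a i 0 l - a i 1 l) / 2) (ρ i) := fun i =>
    ((hint i 0).sub (hint i 1)).div_const 2
  have hsum : ∀ i, (∫ l, |(a i 0 l + a i 1 l) / 2| ∂(ρ i))
      + ∫ l, |(a i 0 l - a i 1 l) / 2| ∂(ρ i) = 1 := fun i => by
    rw [← integral_add (hadd i).abs (hsub i).abs]
    have h : ∀ l, |(a i 0 l + a i 1 l) / 2| + |(a i 0 l - a i 1 l) / 2| = 1 := fun l => by
      rcases ha_val i 0 l with h | h <;> rcases ha_val i 1 l with h' | h' <;>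
        rw [h, h'] <;> norm_num
    simp [h]
  have hI' := abs_integral_prod_mul_le ρ hadd (hb 0)
  have hJ' := abs_integral_prod_mul_le ρ hsub (hb 1)
  rw [← hI] at hI'
  rw [← hJ] at hJ'
  calc |I| ^ ((1:ℝ)/N) + |J| ^ ((1:ℝ)/N)
      ≤ (∏ i, ∫ l, |(a i 0 l + a i 1 l) / 2| ∂(ρ i)) ^ ((1:ℝ)/N)
        + (∏ i, ∫ l, |(a i 0 l - a i 1 l) / 2| ∂(ρ i)) ^ ((1:ℝ)/N) := by gcongr
    _ ≤ (∑ i, ∫ l, |(a i 0 l + a i 1 l) / 2| ∂(ρ i)) / N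
        + (∑ i, ∫ l, |(a i 0 l - a i 1 l) / 2| ∂(ρ i)) / N :=
      add_le_add
        (prod_rpow_one_div_le_sum_div hN0 fun i => integral_nonneg fun l => abs_nonneg _)
        (prod_rpow_one_div_le_sum_div hN0 fun i => integral_nonneg fun l => abs_nonneg _)
    _ = 1 := by
      rw [← add_div, ← Finset.sum_add_distrib]
      simp [hsum, hN0]
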